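/- Assume Hypothesis (B) and suppose moreover that f^(δ)(x_1,…,x_{n−1},0) = 0 defines a smooth hypersurface in P^{n−2}. Let ω_1,…,ω_n ∈ K[x_1,…,x_n] be homogeneous polynomials such that Σ_{i=1}^n (∂f^(δ)/∂x_i) ω_i = 0 and such that f^(δ') ω_n lies in the ideal (∂f^(δ)/∂x_1,…,∂f^(δ)/∂x_{n−1}) of K[x_1,…,x_n]. Then ω_n itself lies in the ideal (∂f^(δ)/∂x_1,…,∂f^(δ)/∂x_{n−1}). -/

import Mathlib

open MvPolynomial

noncomputable section

/-- A polynomial differential `m`-form over `K[x_1,…,x_n]`, recorded by its coefficients: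
to each subset `T ⊆ {1,…,n}` of cardinality `m` (the index set `i_1 < ⋯ < i_m` of
`dx_{i_1} ∧ ⋯ ∧ dx_{i_m}`) we assign a polynomial coefficient. -/
abbrev MForm (K : Type*) [CommSemiring K] (n m : ℕ) : Type _ :=
  ∀ T : Finset (Fin n), T.card = m → MvPolynomial (Fin n) K

/-- The wedge product `dg ∧ ω` of the exterior derivative of `g` with an `m`-form `ω`:
its coefficient on `T = {i_0 < ⋯ < i_m}` is `∑ k, (-1)^k (∂g/∂x_{i_k}) ω(T \ {i_k})`. -/
def wedgeD {K : Type*} [CommRing K] {n m : ℕ} (g : MvPolynomial (Fin n) K)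
    (ω : MForm K n m) : MForm K n (m + 1) := fun T hT =>
  ∑ j ∈ T.attach,
    (-1 : MvPolynomial (Fin n) K) ^ (T.filter (fun i => i < j.1)).card *
      pderiv j.1 g * ω (T.erase j.1) (by rw [Finset.card_erase_of_mem j.2]; omega)

/-- `g` is homogeneous of (possibly negative) degree `d : ℤ`; by convention the only
homogeneous polynomial of negative degree is `0`. -/
def HomogZ {K : Type*} [CommSemiring K] {σ : Type*} (g : MvPolynomial σ K) (d : ℤ) : Prop :=
  g = 0 ∨ ∃ d' : ℕ, (d' : ℤ) = d ∧ g.IsHomogeneous d'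

/-- A list of ring elements is a regular sequence when each entry is a nonzerodivisor
modulo the ideal generated by the preceding entries. -/
def IsRegSeq {R : Type*} [CommRing R] (rs : List R) : Prop :=
  ∀ (i : ℕ) (hi : i < rs.length) (x : R),
    rs[i] * x ∈ Ideal.span {y | ∃ (j : ℕ) (hj : j < i), y = rs[j]'(hj.trans hi)} →
    x ∈ Ideal.span {y | ∃ (j : ℕ) (hj : j < i), y = rs[j]'(hj.trans hi)}

/-- The origin is an isolated critical point of (the polynomial map defined by) `h`:
it is a common zero of all partial derivatives `∂h/∂x_i`, and there is a Zariski-open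
neighborhood `U` of the origin (wlog a basic open set `u ≠ 0` with `u(0) ≠ 0`) on which
the origin is the only common zero of the `∂h/∂x_i`. -/
def IsIsolatedCriticalAtZero {K : Type*} [CommSemiring K] {σ : Type*}
    (h : MvPolynomial σ K) : Prop :=
  (∀ i, eval (0 : σ → K) (pderiv i h) = 0) ∧
  ∃ u : MvPolynomial σ K, eval (0 : σ → K) u ≠ 0 ∧
    ∀ y : σ → K, eval y u ≠ 0 → (∀ i, eval y (pderiv i h) = 0) → y = 0

/-- The dehomogenization of `F` in the affine chart `x_j = 1` of `ℙ^{n-1}`, centered at the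
point `a` (which should satisfy `a j = 1`): a polynomial in the `n-1` variables `i ≠ j`. -/
def chartPoly {K : Type*} [CommRing K] {n : ℕ} (F : MvPolynomial (Fin n) K) (j : Fin n)
    (a : Fin n → K) : MvPolynomial {i : Fin n // i ≠ j} K :=
  aeval (fun i : Fin n => if h : i = j then 1 else X ⟨i, h⟩ + C (a i)) F

/-- `g` is weighted homogeneous of total degree `d`: there are positive integer weights
`α_i` with gcd `1` such that every monomial of `g` has weighted degree `d`
(equivalently, `g(λ^{α_1}x_1,…) = λ^d g(x)`). -/
def IsWeightedHomogTD {K : Type*} [CommSemiring K] {σ : Type*} [Fintype σ]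
    (g : MvPolynomial σ K) (d : ℕ) : Prop :=
  ∃ α : σ → ℕ, (∀ i, 0 < α i) ∧ Finset.univ.gcd α = 1 ∧ IsWeightedHomogeneous α g d

/-- The hypersurface `h = 0` has a weighted homogeneous singularity at the origin, of total
degree `d`: the complete local ring `K[[x]]/(h)` is isomorphic as a `K`-algebra to
`K[[x]]/(g)` for some weighted homogeneous `g` of total degree `d`. -/
def WeightedHomogSing {K : Type*} [Field K] {σ : Type*} [Fintype σ]
    (h : MvPolynomial σ K) (d : ℕ) : Prop :=
  ∃ g : MvPolynomial σ K, IsWeightedHomogTD g d ∧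
    Nonempty ((MvPowerSeries σ K ⧸ Ideal.span {(h : MvPowerSeries σ K)}) ≃ₐ[K]
      MvPowerSeries σ K ⧸ Ideal.span {(g : MvPowerSeries σ K)})

/-- The common zero locus, in the projective space `ℙ^{n-1}`, of a set `S` of
(homogeneous) polynomials. -/
def projZeros {K : Type*} [Field K] {n : ℕ} (S : Set (MvPolynomial (Fin n) K)) :
    Set (Projectivization K (Fin n → K)) :=
  {x | ∃ (v : Fin n → K) (hv : v ≠ 0), Projectivization.mk K v hv = x ∧ ∀ g ∈ S, eval v g = 0}

/-- A homogeneous polynomial `G` in `m` variables defines a smooth hypersurface in `ℙ^{m-1}`: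
`G` and its partial derivatives have no common zero in `ℙ^{m-1}`. -/
def SmoothProj {K : Type*} [Field K] {σ : Type*} (G : MvPolynomial σ K) : Prop :=
  ∀ y : σ → K, y ≠ 0 → ¬ (eval y G = 0 ∧ ∀ i, eval y (pderiv i G) = 0)

/-- `F(x_1,…,x_{n-1},0)`, as a polynomial in the first `n-1` variables. -/
def truncAtLast {K : Type*} [CommRing K] {n : ℕ} (F : MvPolynomial (Fin n) K) :
    MvPolynomial (Fin (n - 1)) K :=
  aeval (fun i : Fin n => if h : (i : ℕ) < n - 1 then X (⟨i, h⟩ : Fin (n - 1)) else 0) F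

/-- `F(y_1,…,y_{n-1},1)`, as a polynomial in the first `n-1` variables. -/
def dehomAtLast {K : Type*} [CommRing K] {n : ℕ} (F : MvPolynomial (Fin n) K) :
    MvPolynomial (Fin (n - 1)) K :=
  aeval (fun i : Fin n => if h : (i : ℕ) < n - 1 then X (⟨i, h⟩ : Fin (n - 1)) else 1) F

/-- The point `(b, 1) ∈ K^n` lying over `b ∈ K^{n-1}` (affine chart `x_n = 1`). -/
def liftPt {K : Type*} [CommRing K] {n : ℕ} (b : Fin (n - 1) → K) : Fin n → K :=
  fun i => if h : (i : ℕ) < n - 1 then b ⟨i, h⟩ else 1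

/-- Context of the paper: `f` has degree `δ ≥ 2`, `1 ≤ δ' ≤ δ - 1`, and
`f = f^(δ) + f^(δ') + (terms of degree < δ')`, with `f^(δ')` the (nonzero) homogeneous
component of second-highest degree. -/
def Setup {K : Type*} [Field K] {n : ℕ} (δ δ' : ℕ) (f : MvPolynomial (Fin n) K) : Prop :=
  f.totalDegree = δ ∧ 2 ≤ δ ∧ 1 ≤ δ' ∧ δ' < δ ∧
  (∀ j, δ' < j → j < δ → homogeneousComponent j f = 0) ∧
  homogeneousComponent δ' f ≠ 0

/-- Hypothesis (A): `p ∤ δ`, `p ∤ δ'`; every singular point of the hypersurface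
`f^(δ) = 0` in `ℙ^{n-1}` (taken with a representative normalized by `a j = 1`) is an
isolated singularity, weighted homogeneous of some total degree `d` with `p ∤ d`,
and does not lie on the hypersurface `f^(δ') = 0`. -/
def HypA {K : Type*} [Field K] {n : ℕ} (p δ δ' : ℕ) (f : MvPolynomial (Fin n) K) : Prop :=
  ¬ (p ∣ δ) ∧ ¬ (p ∣ δ') ∧
  ∀ (a : Fin n → K) (j : Fin n), a j = 1 →
    eval a (homogeneousComponent δ f) = 0 →
    (∀ i, eval a (pderiv i (homogeneousComponent δ f)) = 0) →
    IsIsolatedCriticalAtZero (chartPoly (homogeneousComponent δ f) j a) ∧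
    (∃ d : ℕ, ¬ (p ∣ d) ∧ WeightedHomogSing (chartPoly (homogeneousComponent δ f) j a) d) ∧
    eval a (homogeneousComponent δ' f) ≠ 0

/-- Hypothesis (B): `p ∣ δ`, `p ∤ δ'`, the common zero locus of the `∂f^(δ)/∂x_i` in
`ℙ^{n-1}` is finite and nonempty, and none of its points lies on the hypersurface
`f^(δ') = 0`. -/
def HypB {K : Type*} [Field K] {n : ℕ} (p δ δ' : ℕ) (f : MvPolynomial (Fin n) K) : Prop :=
  (p ∣ δ) ∧ ¬ (p ∣ δ') ∧
  (projZeros {g | ∃ i, g = pderiv i (homogeneousComponent δ f)}).Finite ∧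
  (projZeros {g | ∃ i, g = pderiv i (homogeneousComponent δ f)}).Nonempty ∧
  ∀ a : Fin n → K, a ≠ 0 → (∀ i, eval a (pderiv i (homogeneousComponent δ f)) = 0) →
    eval a (homogeneousComponent δ' f) ≠ 0

/-- The localization of the polynomial ring at the maximal ideal of the point `b`. -/
instance evalKerPrime (K : Type*) [Field K] (σ : Type*) (b : σ → K) :
    (RingHom.ker (eval b : MvPolynomial σ K →+* K)).IsPrime := RingHom.ker_isPrime _

/-- The local ring of affine space at the point `b`, i.e. the localization of the
polynomial ring at the maximal ideal of polynomials vanishing at `b`. -/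
abbrev LocAt (K : Type*) [Field K] {σ : Type*} (b : σ → K) :=
  Localization.AtPrime (RingHom.ker (eval b : MvPolynomial σ K →+* K))

/-- The Milnor number of `h` at the point `b`: the `K`-dimension of the quotient of the
local ring at `b` by the ideal generated by the partial derivatives of `h`. -/
def milnorAt {K : Type*} [Field K] {σ : Type*} (b : σ → K) (h : MvPolynomial σ K) : ℕ :=
  Module.finrank K
    ((LocAt K b) ⧸ Ideal.span (Set.range fun i =>
      algebraMap (MvPolynomial σ K) (LocAt K b) (pderiv i h)))

def DepthGe {R : Type*} [CommRing R] (J : Ideal R) : ℕ → Ideal R → Prop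
  | 0, _ => True
  | r + 1, I => ∃ a ∈ J, (∀ x, a * x ∈ I → x ∈ I) ∧ DepthGe J r (I ⊔ Ideal.span {a})

theorem exists_nzd_module {R : Type*} [CommRing R] [IsNoetherianRing R] (J : Ideal R)
    {M : Type*} [AddCommGroup M] [Module R M] [Module.Finite R M]
    (h : ∀ y : M, (∀ j ∈ J, j • y = 0) → y = 0) :
    ∃ c ∈ J, ∀ y : M, c • y = 0 → y = 0 := by
  by_contra hcon
  push Not at hcon
  have hfin := associatedPrimes.finite R M
  have hsub : (J : Set R) ⊆ ⋃ P ∈ (hfin.toFinset : Set (Ideal R)), (id P : Ideal R) := by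
    intro c hc
    obtain ⟨y, hy, hy0⟩ := hcon c hc
    have : c ∈ ⋃ p ∈ associatedPrimes R M, (p : Set R) := by
      rw [biUnion_associatedPrimes_eq_zero_divisors]
      exact ⟨y, hy0, hy⟩
    simpa using this
  rw [Ideal.subset_union_prime ⊥ ⊥ (by
    intro P hP _ _
    exact ((Set.Finite.mem_toFinset hfin).1 hP).1)] at hsub
  obtain ⟨P, hP, hJP⟩ := hsub
  have hP' := (Set.Finite.mem_toFinset hfin).1 hP
  rw [AssociatedPrimes.mem_iff, isAssociatedPrime_iff] at hP'
  obtain ⟨hpr, y, hy⟩ := hP'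
  have hy0 : y = 0 := by
    apply h
    intro j hj
    have := hJP hj
    rw [id, hy, Submodule.mem_colon_singleton] at this
    simpa using this
  apply hpr.ne_top
  rw [hy, hy0]
  ext; simp [Submodule.mem_colon_singleton]

theorem exists_nzd_three {R : Type*} [CommRing R] [IsNoetherianRing R] (J I₁ I₂ I₃ : Ideal R)
    (h₁ : ∀ y, (∀ j ∈ J, j * y ∈ I₁) → y ∈ I₁)
    (h₂ : ∀ y, (∀ j ∈ J, j * y ∈ I₂) → y ∈ I₂)
    (h₃ : ∀ y, (∀ j ∈ J, j * y ∈ I₃) → y ∈ I₃) :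
    ∃ c ∈ J, (∀ y, c * y ∈ I₁ → y ∈ I₁) ∧ (∀ y, c * y ∈ I₂ → y ∈ I₂) ∧
      (∀ y, c * y ∈ I₃ → y ∈ I₃) := by
  have key : ∀ (I : Ideal R) (c y : R), c • (Ideal.Quotient.mk I y) = 0 ↔ c * y ∈ I := by
    intro I c y
    rw [← Ideal.Quotient.eq_zero_iff_mem, map_mul]
    rfl
  obtain ⟨c, hc, H⟩ := exists_nzd_module J (M := (R ⧸ I₁) × (R ⧸ I₂) × (R ⧸ I₃)) (by
    rintro ⟨y₁, y₂, y₃⟩ hy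
    obtain ⟨y₁, rfl⟩ := Ideal.Quotient.mk_surjective y₁
    obtain ⟨y₂, rfl⟩ := Ideal.Quotient.mk_surjective y₂
    obtain ⟨y₃, rfl⟩ := Ideal.Quotient.mk_surjective y₃
    simp only [Prod.smul_mk, Prod.mk_eq_zero, key] at hy
    simp only [Prod.mk_eq_zero, Ideal.Quotient.eq_zero_iff_mem]
    exact ⟨h₁ _ fun j hj => (hy j hj).1, h₂ _ fun j hj => (hy j hj).2.1,
      h₃ _ fun j hj => (hy j hj).2.2⟩)
  refine ⟨c, hc, fun y hy => ?_, fun y hy => ?_, fun y hy => ?_⟩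
  · have := H (Ideal.Quotient.mk _ y, 0, 0) (by
      simp only [Prod.smul_mk, Prod.mk_eq_zero, key, smul_zero]; exact ⟨hy, trivial, trivial⟩)
    simp only [Prod.mk_eq_zero, Ideal.Quotient.eq_zero_iff_mem] at this
    exact this.1
  · have := H (0, Ideal.Quotient.mk _ y, 0) (by
      simp only [Prod.smul_mk, Prod.mk_eq_zero, key, smul_zero]; exact ⟨trivial, hy, trivial⟩)
    simp only [Prod.mk_eq_zero, Ideal.Quotient.eq_zero_iff_mem] at this
    exact this.2.1
  · have := H (0, 0, Ideal.Quotient.mk _ y) (by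
      simp only [Prod.smul_mk, Prod.mk_eq_zero, key, smul_zero]; exact ⟨trivial, trivial, hy⟩)
    simp only [Prod.mk_eq_zero, Ideal.Quotient.eq_zero_iff_mem] at this
    exact this.2.2

theorem mem_sup_span {R : Type*} [CommRing R] {I : Ideal R} {a x : R} :
    x ∈ I ⊔ Ideal.span {a} ↔ ∃ i ∈ I, ∃ z, x = i + a * z := by
  rw [Submodule.mem_sup]
  constructor
  · rintro ⟨i, hi, z, hz, rfl⟩
    obtain ⟨z, rfl⟩ := Ideal.mem_span_singleton'.1 hz
    exact ⟨i, hi, z, by ring⟩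
  · rintro ⟨i, hi, z, rfl⟩
    exact ⟨i, hi, _, Ideal.mem_span_singleton'.2 ⟨z, rfl⟩, by ring⟩

/-- permuting regular sequences of length two -/
theorem nzd_perm {R : Type*} [CommRing R] {I : Ideal R} {a c : R}
    (ha : ∀ x, a * x ∈ I → x ∈ I)
    (hc : ∀ x, c * x ∈ I ⊔ Ideal.span {a} → x ∈ I ⊔ Ideal.span {a}) :
    ∀ x, a * x ∈ I ⊔ Ideal.span {c} → x ∈ I ⊔ Ideal.span {c} := by
  intro x hx
  obtain ⟨i, hi, y, hy⟩ := mem_sup_span.1 hx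
  have h1 : c * y ∈ I ⊔ Ideal.span {a} :=
    mem_sup_span.2 ⟨-i, I.neg_mem hi, x, by rw [hy]; ring⟩
  obtain ⟨i', hi', z, hz⟩ := mem_sup_span.1 (hc _ h1)
  have h2 : a * (x - c * z) ∈ I := by
    have : a * (x - c * z) = i + c * i' := by
      rw [mul_sub, hy, hz]; ring
    rw [this]
    exact I.add_mem hi (I.mul_mem_left _ hi')
  exact mem_sup_span.2 ⟨_, ha _ h2, z, by ring⟩

theorem depth_swap {R : Type*} [CommRing R] [IsNoetherianRing R] (J : Ideal R) (r : ℕ) :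
    ∀ (I : Ideal R) (b : R), b ∈ J → (∀ x, b * x ∈ I → x ∈ I) → DepthGe J (r + 1) I →
      DepthGe J r (I ⊔ Ideal.span {b}) := by
  induction r with
  | zero => intros; trivial
  | succ r ih =>
    rintro I b hb hbr ⟨a, ha, har, hD⟩
    obtain ⟨c₀, hc₀, hc₀r, -⟩ := id hD
    have h1 : ∀ y, (∀ j ∈ J, j * y ∈ I) → y ∈ I := fun y hy => har y (hy a ha)
    have h2 : ∀ y, (∀ j ∈ J, j * y ∈ I ⊔ Ideal.span {a}) → y ∈ I ⊔ Ideal.span {a} :=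
      fun y hy => hc₀r y (hy c₀ hc₀)
    have h3 : ∀ y, (∀ j ∈ J, j * y ∈ I ⊔ Ideal.span {b}) → y ∈ I ⊔ Ideal.span {b} := by
      intro y hy
      obtain ⟨i, hi, z, hz⟩ := mem_sup_span.1 (hy a ha)
      have hz' : z ∈ I ⊔ Ideal.span {a} := by
        apply h2
        intro j hj
        obtain ⟨i', hi', w, hw⟩ := mem_sup_span.1 (hy j hj)
        have : b * (j * z - a * w) ∈ I := by
          have : b * (j * z - a * w) = a * i' - j * i := by
            linear_combination (-j) * hz + a * hw
          rw [this]
          exact I.sub_mem (I.mul_mem_left _ hi') (I.mul_mem_left _ hi)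
        exact mem_sup_span.2 ⟨_, hbr _ this, w, by ring⟩
      obtain ⟨i', hi', w, rfl⟩ := mem_sup_span.1 hz'
      have : a * (y - b * w) ∈ I := by
        have : a * (y - b * w) = i + b * i' := by linear_combination hz
        rw [this]
        exact I.add_mem hi (I.mul_mem_left _ hi')
      exact mem_sup_span.2 ⟨_, har _ this, w, by ring⟩
    obtain ⟨c, hc, hc1, hc2, hc3⟩ := exists_nzd_three J _ _ _ h1 h2 h3
    have e1 := ih _ c hc hc2 hD
    have e2 : DepthGe J (r + 1) (I ⊔ Ideal.span {c}) :=
      ⟨a, ha, nzd_perm har hc2, by rwa [sup_right_comm]⟩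
    have e3 := ih _ b hb (nzd_perm hbr hc3) e2
    exact ⟨c, hc, hc3, by rwa [sup_right_comm]⟩

theorem depth_le_dim {S : Type*} [CommRing S] [IsNoetherianRing S] [IsLocalRing S] (r : ℕ) :
    ∀ (I P : Ideal S) (_ : P.IsPrime) (x : S), (∀ s, s ∈ P ↔ s * x ∈ I) →
      DepthGe (IsLocalRing.maximalIdeal S) r I → (r : WithBot ℕ∞) ≤ ringKrullDim (S ⧸ P) := by
  induction r with
  | zero =>
    intro I P hP x hx _
    simpa using ringKrullDim_nonneg_of_nontrivial
  | succ r ih =>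
    rintro I P hP x hx ⟨a, ha, har, hD⟩
    -- the submodule killed by P
    let N : Ideal S :=
      { carrier := {y | ∀ s ∈ P, s * y ∈ I}
        add_mem' := by
          intro y z hy hz s hs
          rw [mul_add]; exact I.add_mem (hy s hs) (hz s hs)
        zero_mem' := by intro s _; simp
        smul_mem' := by
          intro c y hy s hs
          rw [smul_eq_mul, mul_left_comm]; exact I.mul_mem_left _ (hy s hs) }
    have hxN : x ∈ N := fun s hs => (hx s).1 hs
    have hxI : x ∉ I := by
      intro h
      exact hP.ne_top ((Ideal.eq_top_iff_one _).2 ((hx 1).2 (by simpa using h)))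
    have hN : ¬ N ≤ I ⊔ Ideal.span {a} := by
      intro hle
      apply hxI
      have : N ≤ I ⊔ (IsLocalRing.maximalIdeal S) • N := by
        intro y hy
        obtain ⟨i, hi, z, hz⟩ := mem_sup_span.1 (hle hy)
        have hzN : z ∈ N := by
          intro s hs
          apply har
          have : a * (s * z) = s * y - s * i := by rw [hz]; ring
          rw [this]
          exact I.sub_mem (hy s hs) (I.mul_mem_left _ hi)
        rw [hz]
        exact Submodule.add_mem_sup hi (Submodule.smul_mem_smul ha hzN)
      have h2 := Submodule.le_of_le_smul_of_le_jacobson_bot (N := I) (N' := N)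
        (I := IsLocalRing.maximalIdeal S) (IsNoetherian.noetherian N)
        (IsLocalRing.maximalIdeal_le_jacobson _) this
      exact h2 hxN
    obtain ⟨y, hyN, hy⟩ := SetLike.not_le_iff_exists.1 hN
    obtain ⟨Q, hQ, hQy⟩ := exists_le_isAssociatedPrime_of_isNoetherianRing S
      (Ideal.Quotient.mk (I ⊔ Ideal.span {a}) y)
      (by rwa [Ne, Ideal.Quotient.eq_zero_iff_mem])
    rw [isAssociatedPrime_iff] at hQ
    obtain ⟨hQp, w, hw⟩ := hQ
    obtain ⟨w, rfl⟩ := Ideal.Quotient.mk_surjective w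
    have key : ∀ (c y : S), c ∈ (⊥ : Submodule S (S ⧸ (I ⊔ Ideal.span {a}))).colon
        {Ideal.Quotient.mk (I ⊔ Ideal.span {a}) y} ↔ c * y ∈ I ⊔ Ideal.span {a} := by
      intro c y
      rw [Submodule.mem_colon_singleton, Submodule.mem_bot, ← Ideal.Quotient.eq_zero_iff_mem,
        map_mul]
      rfl
    have hPQ : P ≤ Q := fun s hs => hQy ((key s y).2 (Ideal.mem_sup_left (hyN s hs)))
    have haQ : a ∈ Q := hQy ((key a y).2 (Ideal.mem_sup_right
      (Ideal.mul_mem_right _ _ (Ideal.mem_span_singleton_self a))))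
    have haP : a ∉ P := fun h => hxI (har x ((hx a).1 h))
    have hr := ih _ Q hQp w (fun s => by rw [hw]; exact key s w) hD
    have h1 : ringKrullDim ((S ⧸ P) ⧸ Ideal.span {Ideal.Quotient.mk P a}) + 1
        ≤ ringKrullDim (S ⧸ P) := by
      apply ringKrullDim_quotient_succ_le_of_nonZeroDivisor
      rw [mem_nonZeroDivisors_iff_ne_zero, Ne, Ideal.Quotient.eq_zero_iff_mem]
      exact haP
    have h2 : ringKrullDim (S ⧸ Q) ≤
        ringKrullDim ((S ⧸ P) ⧸ Ideal.span {Ideal.Quotient.mk P a}) := by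
      refine ringKrullDim_le_of_surjective
        (Ideal.Quotient.lift _ (Ideal.Quotient.factor hPQ) ?_) ?_
      · intro b hb
        obtain ⟨c, rfl⟩ := Ideal.mem_span_singleton'.1 hb
        rw [map_mul, Ideal.Quotient.factor_mk, Ideal.Quotient.eq_zero_iff_mem.2 haQ, mul_zero]
      · exact Ideal.Quotient.lift_surjective_of_surjective _ _ (Ideal.Quotient.factor_surjective hPQ)
    calc ((r + 1 : ℕ) : WithBot ℕ∞) = (r : WithBot ℕ∞) + 1 := by push_cast; rfl
      _ ≤ ringKrullDim (S ⧸ Q) + 1 := by gcongr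
      _ ≤ _ := by gcongr
      _ ≤ _ := h1

theorem dim_le_add_length {S : Type*} [CommRing S] [IsNoetherianRing S] [IsLocalRing S]
    (P I : Ideal S) (bs : List S) (hbs : ∀ b ∈ bs, b ∈ IsLocalRing.maximalIdeal S)
    (hP : P ≠ ⊤) (hI : I ≤ P ⊔ Ideal.ofList bs) :
    ringKrullDim (S ⧸ P) ≤ ringKrullDim (S ⧸ I) + bs.length := by
  classical
  have : Nontrivial (S ⧸ P) := Ideal.Quotient.nontrivial_iff.2 hP
  have : IsLocalRing (S ⧸ P) :=
    IsLocalRing.of_surjective' (Ideal.Quotient.mk P) Ideal.Quotient.mk_surjective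
  let s : Finset (S ⧸ P) := (bs.map (Ideal.Quotient.mk P)).toFinset
  have h1 := ringKrullDim_le_ringKrullDim_quotient_add_card s (by
    intro y hy
    rw [IsLocalRing.ringJacobson_eq_maximalIdeal]
    simp only [s, List.coe_toFinset, List.mem_map, Set.mem_ofPred_eq] at hy
    obtain ⟨b, hb, rfl⟩ := hy
    have hb' := hbs b hb
    have := IsLocalHom.of_surjective (Ideal.Quotient.mk P) Ideal.Quotient.mk_surjective
    exact (IsLocalRing.mem_maximalIdeal _).2 (fun h =>
      (IsLocalRing.mem_maximalIdeal _).1 hb' (isUnit_of_map_unit _ _ h)))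
  have h2 : ringKrullDim ((S ⧸ P) ⧸ Ideal.span (s : Set (S ⧸ P))) ≤ ringKrullDim (S ⧸ I) := by
    refine ringKrullDim_le_of_surjective (Ideal.Quotient.lift _
      ((Ideal.Quotient.mk (Ideal.span (s : Set (S ⧸ P)))).comp (Ideal.Quotient.mk P)) ?_) ?_
    · intro b hb
      have hle : P ⊔ Ideal.ofList bs ≤ RingHom.ker
        ((Ideal.Quotient.mk (Ideal.span (s : Set (S ⧸ P)))).comp (Ideal.Quotient.mk P)) := by
        refine sup_le ?_ ?_
        · intro c hc
          rw [RingHom.mem_ker, RingHom.comp_apply, Ideal.Quotient.eq_zero_iff_mem.2 hc, map_zero]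
        · rw [Ideal.ofList, Ideal.span_le]
          intro c hc
          change _ = _
          rw [RingHom.comp_apply, Ideal.Quotient.eq_zero_iff_mem]
          apply Ideal.subset_span
          simp only [s, List.coe_toFinset, List.mem_map, Set.mem_ofPred_eq]
          exact ⟨c, hc, rfl⟩
      exact hle (hI hb)
    · apply Ideal.Quotient.lift_surjective_of_surjective
      exact Ideal.Quotient.mk_surjective.comp Ideal.Quotient.mk_surjective
  refine h1.trans ?_
  have h3 : s.card ≤ bs.length := (List.toFinset_card_le _).trans (by simp)
  gcongr

theorem depth_one_of_dim {S : Type*} [CommRing S] [IsNoetherianRing S] [IsLocalRing S]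
    (bs : List S) : ∀ (I : Ideal S), (∀ b ∈ bs, b ∈ IsLocalRing.maximalIdeal S) →
      ringKrullDim (S ⧸ (I ⊔ Ideal.ofList bs)) ≤ 1 →
      DepthGe (IsLocalRing.maximalIdeal S) (bs.length + 1) I →
      DepthGe (IsLocalRing.maximalIdeal S) 1 (I ⊔ Ideal.ofList bs) := by
  induction bs with
  | nil => intro I _ _ h; simpa using h
  | cons b bs ih =>
    intro I hbs hdim hD
    have hsup : I ⊔ Ideal.ofList (b :: bs) = (I ⊔ Ideal.span {b}) ⊔ Ideal.ofList bs := by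
      rw [Ideal.ofList_cons, sup_assoc]
    rw [hsup] at hdim ⊢
    have hb : b ∈ IsLocalRing.maximalIdeal S := hbs b (by simp)
    have hbs' : ∀ b ∈ bs, b ∈ IsLocalRing.maximalIdeal S := fun c hc => hbs c (by simp [hc])
    apply ih _ hbs' hdim
    apply depth_swap _ _ _ _ hb _ hD
    intro x hx
    by_contra hxI
    have key : ∀ (c y : S), c ∈ (⊥ : Submodule S (S ⧸ I)).colon
        {Ideal.Quotient.mk I y} ↔ c * y ∈ I := by
      intro c y
      rw [Submodule.mem_colon_singleton, Submodule.mem_bot, ← Ideal.Quotient.eq_zero_iff_mem,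
        map_mul]
      rfl
    obtain ⟨P, hP, hPx⟩ := exists_le_isAssociatedPrime_of_isNoetherianRing S
      (Ideal.Quotient.mk I x) (by rwa [Ne, Ideal.Quotient.eq_zero_iff_mem])
    rw [isAssociatedPrime_iff] at hP
    obtain ⟨hPp, w, hw⟩ := hP
    obtain ⟨w, rfl⟩ := Ideal.Quotient.mk_surjective w
    have hbP : b ∈ P := hPx ((key b x).2 hx)
    have hIP : I ≤ P := fun s hs => hPx ((key s x).2 (I.mul_mem_right _ hs))
    have h1 := depth_le_dim _ I P hPp w (fun s => by rw [hw]; exact key s w) hD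
    have h2 := dim_le_add_length P ((I ⊔ Ideal.span {b}) ⊔ Ideal.ofList bs) bs hbs' hPp.ne_top
      (sup_le_sup_right (sup_le hIP ((Ideal.span_singleton_le_iff_mem _).2 hbP)) _)
    have h3 : (((b :: bs).length + 1 : ℕ) : WithBot ℕ∞) ≤ ((1 + bs.length : ℕ) : WithBot ℕ∞) := by
      refine h1.trans (h2.trans ?_)
      push_cast
      gcongr
    have h4 : (b :: bs).length + 1 ≤ 1 + bs.length := by exact_mod_cast h3
    simp at h4
    omega

theorem dim_le_one {S : Type*} [CommRing S] [IsNoetherianRing S] [IsLocalRing S]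
    (I : Ideal S) (H : ∀ P : Ideal S, P.IsPrime → I ≤ P → ∃ h ∈ IsLocalRing.maximalIdeal S,
      ∀ Q : Ideal S, Q.IsPrime → P ≤ Q → h ∈ Q → Q = IsLocalRing.maximalIdeal S) :
    ringKrullDim (S ⧸ I) ≤ 1 := by
  have : Ring.KrullDimLE 1 (S ⧸ I) := by
    rw [Ring.krullDimLE_one_iff]
    intro q hq
    rw [or_iff_not_imp_left]
    intro hmin
    rw [minimalPrimes_eq_minimals, Set.notMem_ofPred_iff, not_minimal_iff_exists_lt hq] at hmin
    obtain ⟨p, hlt, hp⟩ := hmin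
    set φ := Ideal.Quotient.mk I
    have hφ : Function.Surjective φ := Ideal.Quotient.mk_surjective
    have hp' : (p.comap φ).IsPrime := inferInstance
    have hq' : (q.comap φ).IsPrime := inferInstance
    have hI : I ≤ p.comap φ := by
      intro x hx
      rw [Ideal.mem_comap, Ideal.Quotient.eq_zero_iff_mem.2 hx]; exact p.zero_mem
    obtain ⟨h, hh, hQ⟩ := H _ hp' hI
    have hlt' : p.comap φ < q.comap φ := by
      refine lt_of_le_of_ne (Ideal.comap_mono hlt.le) fun e => hlt.ne ?_
      exact Ideal.comap_injective_of_surjective φ hφ e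
    have hd0 : ringKrullDim (S ⧸ (p.comap φ ⊔ Ideal.ofList [h])) ≤ 0 := by
      have : Ring.KrullDimLE 0 (S ⧸ (p.comap φ ⊔ Ideal.ofList [h])) := by
        refine .mk₀ fun Q hQp => ?_
        have h1 : (Q.comap (Ideal.Quotient.mk (p.comap φ ⊔ Ideal.ofList [h]))).IsPrime :=
          inferInstance
        have hle : p.comap φ ⊔ Ideal.ofList [h] ≤
            Q.comap (Ideal.Quotient.mk (p.comap φ ⊔ Ideal.ofList [h])) := by
          intro x hx
          rw [Ideal.mem_comap, Ideal.Quotient.eq_zero_iff_mem.2 hx]; exact Q.zero_mem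
        have h2 := hQ _ h1 (le_sup_left.trans hle) (hle (Ideal.mem_sup_right (by simp)))
        have h3 : (Q.comap (Ideal.Quotient.mk (p.comap φ ⊔ Ideal.ofList [h]))).IsMaximal := by
          rw [h2]; infer_instance
        rw [← Ideal.map_comap_of_surjective _ Ideal.Quotient.mk_surjective Q]
        refine (Ideal.map_eq_top_or_isMaximal_of_surjective _ Ideal.Quotient.mk_surjective h3
          ).resolve_left ?_
        rw [Ideal.map_comap_of_surjective _ Ideal.Quotient.mk_surjective Q]
        exact hQp.ne_top
      exact Ring.krullDimLE_iff.1 this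
    have hd1 : ringKrullDim (S ⧸ p.comap φ) ≤ 1 := by
      refine (dim_le_add_length (p.comap φ) _ [h] (by simpa using hh) hp'.ne_top le_rfl).trans ?_
      calc _ ≤ (0 : WithBot ℕ∞) + (([h] : List S).length : WithBot ℕ∞) := by gcongr
        _ ≤ 1 := by simp
    have : Ring.KrullDimLE 1 (S ⧸ p.comap φ) := Ring.krullDimLE_iff.2 hd1
    have hqq : ((q.comap φ).map (Ideal.Quotient.mk (p.comap φ))).IsPrime :=
      Ideal.map_isPrime_of_surjective Ideal.Quotient.mk_surjective (by simpa using hlt'.le)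
    have hm := hqq.isMaximal_of_ne_bot (by
      intro e
      rw [Ideal.map_eq_bot_iff_le_ker, Ideal.mk_ker] at e
      exact absurd e (not_le_of_gt hlt'))
    have hm2 := Ideal.comap_isMaximal_of_surjective (Ideal.Quotient.mk (p.comap φ))
      Ideal.Quotient.mk_surjective (K := (q.comap φ).map (Ideal.Quotient.mk (p.comap φ)))
    rw [Ideal.comap_map_of_surjective _ Ideal.Quotient.mk_surjective, ← RingHom.ker_eq_comap_bot,
      Ideal.mk_ker, sup_eq_left.2 hlt'.le] at hm2
    rw [← Ideal.map_comap_of_surjective φ hφ q]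
    refine (Ideal.map_eq_top_or_isMaximal_of_surjective _ hφ hm2).resolve_left ?_
    rw [Ideal.map_comap_of_surjective φ hφ q]
    exact hq.ne_top
  exact Ring.krullDimLE_iff.1 this

theorem depth_localization {R S : Type*} [CommRing R] [CommRing S] [Algebra R S]
    (M : Submonoid R) [IsLocalization M S] (J : Ideal R) (r : ℕ) : ∀ I : Ideal R,
    DepthGe J r I → DepthGe (J.map (algebraMap R S)) r (I.map (algebraMap R S)) := by
  induction r with
  | zero => intros; trivial
  | succ r ih =>
    rintro I ⟨a, ha, har, hD⟩
    refine ⟨algebraMap R S a, Ideal.mem_map_of_mem _ ha, ?_, ?_⟩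
    · intro y hy
      obtain ⟨x, s, rfl⟩ := IsLocalization.exists_mk'_eq M y
      rw [IsLocalization.mk'_mem_map_algebraMap_iff]
      rw [← IsLocalization.mk'_one (M := M) S a, ← IsLocalization.mk'_mul,
        IsLocalization.mk'_mem_map_algebraMap_iff] at hy
      obtain ⟨t, ht, hx⟩ := hy
      exact ⟨t, ht, har _ (by rwa [mul_left_comm])⟩
    · have := ih _ hD
      rwa [Ideal.map_sup, Ideal.map_span, Set.image_singleton] at this

theorem depth_mvPolynomial {K : Type*} [Field K] {n : ℕ} (J : Ideal (MvPolynomial (Fin n) K))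
    (hJ : ∀ i, X i ∈ J) (r k : ℕ) (h : k + r = n) :
    DepthGe J r (Ideal.span (X '' {i : Fin n | (i : ℕ) < k})) := by
  induction r generalizing k with
  | zero => trivial
  | succ r ih =>
    refine ⟨X ⟨k, by omega⟩, hJ _, ?_, ?_⟩
    · intro x hx
      rw [mem_ideal_span_X_image] at hx ⊢
      intro m hm
      obtain ⟨i, hi, hmi⟩ := hx (Finsupp.single ⟨k, by omega⟩ 1 + m) (by
        rw [mem_support_iff, coeff_X_mul]; exact mem_support_iff.1 hm)
      refine ⟨i, hi, ?_⟩
      have : (⟨k, by omega⟩ : Fin n) ≠ i := by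
        rintro rfl
        simp at hi
      rwa [Finsupp.add_apply, Finsupp.single_eq_of_ne this.symm, zero_add] at hmi
    · have := ih (k + 1) (by omega)
      convert this using 1
      rw [← Ideal.span_union]
      congr 1
      rw [← Set.image_singleton, ← Set.image_union]
      congr 1
      ext i
      simp [Fin.ext_iff]
      omega

theorem ker_le_radical {K : Type*} [Field K] [IsAlgClosed K] {n : ℕ}
    (Q : Ideal (MvPolynomial (Fin n) K))
    (h : ∀ v : Fin n → K, (∀ g ∈ Q, eval v g = 0) → v = 0) :
    RingHom.ker (eval (0 : Fin n → K)) ≤ Q.radical := by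
  intro g hg
  rw [← vanishingIdeal_zeroLocus_eq_radical (K := K), mem_vanishingIdeal_iff]
  intro v hv
  rw [mem_zeroLocus_iff] at hv
  have : v = 0 := h v (fun g hg => by simpa using hv g hg)
  subst this
  simpa [RingHom.mem_ker] using hg

theorem mem_of_colon_zero {K : Type*} [Field K] [IsAlgClosed K] {n : ℕ}
    (bs : List (MvPolynomial (Fin n) K)) (hlen : bs.length + 1 = n)
    (hbs : ∀ b ∈ bs, eval 0 b = 0)
    (H : ∀ P : Ideal (MvPolynomial (Fin n) K), P.IsPrime → Ideal.ofList bs ≤ P →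
      ∃ h, eval 0 h = 0 ∧ ∀ v : Fin n → K, (∀ g ∈ P, eval v g = 0) → eval v h = 0 → v = 0)
    (w : MvPolynomial (Fin n) K)
    (hw : ∀ v : Fin n → K, (∀ g, g * w ∈ Ideal.ofList bs → eval v g = 0) → v = 0) :
    w ∈ Ideal.ofList bs := by
  set m := RingHom.ker (eval (0 : Fin n → K)) with hm
  have hmp : m.IsPrime := RingHom.ker_isPrime _
  have hmm : m.IsMaximal := RingHom.ker_isMaximal_of_surjective _
    (fun c => ⟨C c, by simp⟩)
  let S := Localization.AtPrime m
  have hmax : m.map (algebraMap _ S) = IsLocalRing.maximalIdeal S :=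
    Localization.AtPrime.map_eq_maximalIdeal
  have : IsNoetherianRing S := IsLocalization.isNoetherianRing m.primeCompl S inferInstance
  set I := Ideal.ofList bs with hI
  have hImap : I.map (algebraMap _ S) = Ideal.ofList (bs.map (algebraMap _ S)) := by
    rw [hI, Ideal.map_ofList]
  have hdepth : DepthGe (IsLocalRing.maximalIdeal S) n (⊥ : Ideal S) := by
    have h0 := depth_mvPolynomial (K := K) (n := n) m
      (fun i => by rw [hm, RingHom.mem_ker]; simp) n 0 (by omega)
    have h1 := depth_localization (S := S) m.primeCompl m n _ h0
    rw [hmax] at h1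
    convert h1 using 1
    simp
  have hdim : ringKrullDim (S ⧸ (⊥ ⊔ Ideal.ofList (bs.map (algebraMap _ S)))) ≤ 1 := by
    rw [bot_sup_eq, ← hImap]
    apply dim_le_one
    intro P' hP' hIP'
    have hP : (P'.comap (algebraMap (MvPolynomial (Fin n) K) S)).IsPrime := inferInstance
    obtain ⟨h, hh, hv⟩ := H _ hP (Ideal.map_le_iff_le_comap.1 hIP')
    refine ⟨algebraMap _ S h, ?_, ?_⟩
    · rw [← hmax]; exact Ideal.mem_map_of_mem _ (by rw [hm, RingHom.mem_ker]; exact hh)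
    · intro Q hQ hPQ hhQ
      have hQc : (Q.comap (algebraMap (MvPolynomial (Fin n) K) S)).IsPrime := inferInstance
      have hle := ker_le_radical (Q.comap (algebraMap (MvPolynomial (Fin n) K) S)) (fun v hv' =>
        hv v (fun g hg => hv' g (hPQ hg)) (hv' h hhQ))
      rw [hQc.isRadical.radical] at hle
      apply le_antisymm (IsLocalRing.le_maximalIdeal hQ.ne_top)
      rw [← hmax]
      exact Ideal.map_le_iff_le_comap.2 hle
  have hone := depth_one_of_dim (bs.map (algebraMap _ S)) ⊥ (by
    intro b hb
    obtain ⟨c, hc, rfl⟩ := List.mem_map.1 hb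
    rw [← hmax]; exact Ideal.mem_map_of_mem _ (by rw [hm, RingHom.mem_ker]; exact hbs c hc)) hdim
    (by rw [List.length_map, hlen]; exact hdepth)
  rw [bot_sup_eq, ← hImap] at hone
  obtain ⟨c, hc, hcr, -⟩ := hone
  let A : Ideal (MvPolynomial (Fin n) K) :=
    { carrier := {g | g * w ∈ I}
      add_mem' := by
        intro y z hy hz
        change (y + z) * w ∈ I
        rw [add_mul]; exact I.add_mem hy hz
      zero_mem' := by change 0 * w ∈ I; simp
      smul_mem' := by
        intro c y hy
        change (c • y) * w ∈ I
        rw [smul_eq_mul, mul_assoc]; exact I.mul_mem_left _ hy }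
  have hA : m ≤ A.radical := ker_le_radical A hw
  obtain ⟨k, hk⟩ := Ideal.exists_pow_le_of_le_radical_of_fg hA (IsNoetherian.noetherian m)
  have hck : c ^ k ∈ A.map (algebraMap _ S) := by
    apply Ideal.map_mono hk
    rw [Ideal.map_pow, hmax]
    exact Ideal.pow_mem_pow hc k
  have hckw : c ^ k * algebraMap _ S w ∈ I.map (algebraMap _ S) := by
    obtain ⟨⟨⟨g, hg⟩, s⟩, hgs⟩ := (IsLocalization.mem_map_algebraMap_iff m.primeCompl S).1 hck
    obtain ⟨x, t, hx⟩ := IsLocalization.exists_mk'_eq m.primeCompl (c ^ k)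
    rw [← hx, IsLocalization.mk'_mem_map_algebraMap_iff] at hck
    obtain ⟨u, hu, hux⟩ := hck
    rw [← hx, ← IsLocalization.mk'_one (M := m.primeCompl) S w, ← IsLocalization.mk'_mul,
        IsLocalization.mk'_mem_map_algebraMap_iff]
    exact ⟨u, hu, by rw [← mul_assoc]; exact hux⟩
  have hwS : ∀ j : ℕ, ∀ y : S, c ^ j * y ∈ I.map (algebraMap _ S) →
      y ∈ I.map (algebraMap _ S) := by
    intro j
    induction j with
    | zero => intro y hy; simpa using hy
    | succ j ih =>
      intro y hy
      exact ih _ (hcr _ (by rwa [pow_succ', mul_assoc] at hy))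
  have hwI := hwS k _ hckw
  rw [← IsLocalization.mk'_one (M := m.primeCompl) S w,
    IsLocalization.mk'_mem_map_algebraMap_iff] at hwI
  obtain ⟨s, hs, hsw⟩ := hwI
  have hAtop : A = ⊤ := by
    by_contra hne
    obtain ⟨M, hM, hAM⟩ := Ideal.exists_le_maximal A hne
    have h1 : m ≤ M := hA.trans (by
      rw [← hM.isPrime.isRadical.radical]; exact Ideal.radical_mono hAM)
    have h2 : m = M := hmm.eq_of_le hM.ne_top h1
    exact hs (h2 ▸ hAM hsw)
  have : (1 : MvPolynomial (Fin n) K) ∈ A := hAtop ▸ Submodule.mem_top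
  have h1 : 1 * w ∈ I := this
  simpa using h1

theorem eval_zero_of_homog {K : Type*} [Field K] {n d : ℕ} {g : MvPolynomial (Fin n) K}
    (hg : g.IsHomogeneous d) (hd : d ≠ 0) : eval 0 g = 0 := by
  have h0 : coeff 0 g = 0 := hg.coeff_eq_zero (by simpa using hd.symm)
  rw [← h0, ← constantCoeff_eq, eval_zero]

theorem trunc_eval {K : Type*} [Field K] {n : ℕ} (F : MvPolynomial (Fin n) K) (v : Fin n → K)
    (hlt : n - 1 < n) (hv : v ⟨n - 1, hlt⟩ = 0) :
    eval (fun i : Fin (n - 1) => v ⟨i, by omega⟩) (truncAtLast F) = eval v F := by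
  unfold truncAtLast
  rw [← MvPolynomial.coe_aeval_eq_eval, RingHom.coe_coe, ← AlgHom.comp_apply, comp_aeval,
    ← MvPolynomial.coe_aeval_eq_eval, RingHom.coe_coe]
  congr 2
  funext i
  split_ifs with h
  · simp
  · have : i = ⟨n - 1, hlt⟩ := by ext; simp; omega
    rw [this, hv]; simp

theorem trunc_pderiv {K : Type*} [Field K] {n : ℕ} (F : MvPolynomial (Fin n) K)
    (i : Fin (n - 1)) :
    pderiv i (truncAtLast F) = truncAtLast (pderiv (⟨i, by omega⟩ : Fin n) F) := by
  unfold truncAtLast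
  induction F using MvPolynomial.induction_on with
  | C a => simp
  | add p q hp hq => simp only [map_add, hp, hq]
  | mul_X p j hp =>
    simp only [map_mul, map_add, Derivation.leibniz, hp, smul_eq_mul, aeval_X, pderiv_X]
    congr 2
    split_ifs with h
    · rw [pderiv_X]
      by_cases hij : i = ⟨j, h⟩
      · subst hij; simp
      · rw [Pi.single_eq_of_ne (Ne.symm hij), Pi.single_eq_of_ne, map_zero]
        rintro rfl; exact hij rfl
    · rw [Pi.single_eq_of_ne]
      · simp
      · rintro rfl; exact h i.2

/-- Lemma 5.10: under Hypothesis (B) (with `f^(δ)(x_1,…,x_{n-1},0) = 0` a smooth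
hypersurface in `ℙ^{n-2}`), if homogeneous `ω_1, …, ω_n` satisfy
`∑ (∂f^(δ)/∂x_i) ω_i = 0` and `f^(δ') ω_n ∈ (∂f^(δ)/∂x_1, …, ∂f^(δ)/∂x_{n-1})`,
then `ω_n ∈ (∂f^(δ)/∂x_1, …, ∂f^(δ)/∂x_{n-1})`. -/
theorem statement17 {K : Type*} [Field K] [IsAlgClosed K] (p : ℕ) [CharP K p]
    (hp : p.Prime) {n : ℕ} (hn : 2 ≤ n) (f : MvPolynomial (Fin n) K) (δ δ' : ℕ)
    (hsetup : Setup δ δ' f) (hB : HypB p δ δ' f)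
    (hsmooth : SmoothProj (truncAtLast (homogeneousComponent δ f)))
    (ω : Fin n → MvPolynomial (Fin n) K)
    (hω : ∀ i, ∃ d, (ω i).IsHomogeneous d)
    (hrel : ∑ i, pderiv i (homogeneousComponent δ f) * ω i = 0)
    (hmem : homogeneousComponent δ' f * ω ⟨n - 1, by omega⟩ ∈
      Ideal.span {y | ∃ j : Fin n, (j : ℕ) < n - 1 ∧
        y = pderiv j (homogeneousComponent δ f)}) :
    ω ⟨n - 1, by omega⟩ ∈
      Ideal.span {y | ∃ j : Fin n, (j : ℕ) < n - 1 ∧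
        y = pderiv j (homogeneousComponent δ f)} := by
  obtain ⟨-, hδ, hδ', -, -, -⟩ := hsetup
  obtain ⟨hpδ, -, -, -, hB⟩ := hB
  have hF : (homogeneousComponent δ f).IsHomogeneous δ := homogeneousComponent_isHomogeneous _ _
  have hG : (homogeneousComponent δ' f).IsHomogeneous δ' := homogeneousComponent_isHomogeneous _ _
  set F := homogeneousComponent δ f with hFdef
  set G := homogeneousComponent δ' f with hGdef
  have hlt : n - 1 < n := by omega
  set N : Fin n := ⟨n - 1, hlt⟩ with hN
  have hspan : Ideal.span {y | ∃ j : Fin n, (j : ℕ) < n - 1 ∧ y = pderiv j F} =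
      Ideal.ofList (List.ofFn fun i : Fin (n - 1) => pderiv (⟨i, by omega⟩ : Fin n) F) := by
    rw [Ideal.ofList]
    congr 1
    ext y
    simp only [Set.mem_ofPred_eq, List.mem_ofFn]
    constructor
    · rintro ⟨j, hj, rfl⟩; exact ⟨⟨j, hj⟩, rfl⟩
    · rintro ⟨j, rfl⟩; exact ⟨⟨j, by omega⟩, j.2, rfl⟩
  set bs := List.ofFn fun i : Fin (n - 1) => pderiv (⟨i, by omega⟩ : Fin n) F with hbs
  have hmemI : ∀ j : Fin n, j ≠ N → pderiv j F ∈ Ideal.ofList bs := by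
    intro j hj
    rw [← hspan]
    refine Ideal.subset_span ⟨j, ?_, rfl⟩
    have : (j : ℕ) ≠ n - 1 := fun h => hj (Fin.ext h)
    omega
  have hcrit : ∀ P : Ideal (MvPolynomial (Fin n) K), Ideal.ofList bs ≤ P → pderiv N F ∈ P →
      ∀ j, pderiv j F ∈ P := by
    intro P hP hN j
    by_cases hj : j = N
    · rw [hj]; exact hN
    · exact hP (hmemI j hj)
  have hXF : X N * pderiv N F ∈ Ideal.ofList bs := by
    have h1 := hF.sum_X_mul_pderiv
    have h2 : (δ : MvPolynomial (Fin n) K) = 0 := by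
      rw [← map_natCast (C : K →+* MvPolynomial (Fin n) K), (CharP.cast_eq_zero_iff K p δ).2 hpδ,
        C_0]
    rw [nsmul_eq_mul, h2, zero_mul, ← Finset.add_sum_erase _ _ (Finset.mem_univ N)] at h1
    rw [eq_neg_of_add_eq_zero_left h1]
    refine neg_mem (Ideal.sum_mem _ fun j hj => Ideal.mul_mem_left _ _ (hmemI j ?_))
    exact Finset.ne_of_mem_erase hj
  rw [hspan] at hmem ⊢
  refine mem_of_colon_zero bs (by rw [hbs, List.length_ofFn]; omega) ?_ ?_ _ ?_
  · intro b hb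
    rw [hbs, List.mem_ofFn] at hb
    obtain ⟨j, rfl⟩ := hb
    exact eval_zero_of_homog hF.pderiv (by omega)
  · intro P hP hIP
    rcases hP.mem_or_mem (hIP hXF) with hx | hx
    · refine ⟨F, eval_zero_of_homog hF (by omega), ?_⟩
      intro v hv hvF
      by_contra hv0
      have hvN : v N = 0 := by simpa using hv _ hx
      refine hsmooth (fun i : Fin (n - 1) => v ⟨i, by omega⟩) ?_ ⟨?_, ?_⟩
      · intro h0
        apply hv0
        funext i
        by_cases hi : i = N
        · rw [hi, hvN]; rfl
        · have hi' : (i : ℕ) < n - 1 := by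
            have : (i : ℕ) ≠ n - 1 := fun h => hi (Fin.ext h)
            omega
          exact congrFun h0 ⟨i, hi'⟩
      · rw [trunc_eval F v hlt hvN]; exact hvF
      · intro i
        rw [trunc_pderiv, trunc_eval _ v hlt hvN]
        apply hv
        apply hIP
        apply hmemI
        intro h
        have := congrArg Fin.val h
        simp only [hN] at this
        omega
    · refine ⟨G, eval_zero_of_homog hG (by omega), ?_⟩
      intro v hv hvG
      by_contra hv0
      exact hB v hv0 (fun i => hv _ (hcrit P hIP hx i)) hvG
  · intro v hv
    by_contra hv0
    refine hB v hv0 ?_ (hv _ hmem)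
    intro j
    by_cases hj : j = N
    · rw [hj]
      apply hv
      rw [← Finset.add_sum_erase _ _ (Finset.mem_univ N)] at hrel
      rw [eq_neg_of_add_eq_zero_left hrel]
      refine neg_mem (Ideal.sum_mem _ fun j hj => Ideal.mul_mem_right _ _ (hmemI j ?_))
      exact Finset.ne_of_mem_erase hj
    · exact hv _ (Ideal.mul_mem_right _ _ (hmemI j hj))

end
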